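/- The spectrum of the bounded self-adjoint operator Δ on L²(dν)q⁰ equals the segment [−1/(1−q)², −1/(1+q)²], and Δ has no eigenvalues (its point spectrum is empty). -/

import Mathlib

open scoped BigOperators ENNReal

noncomputable section
/-- The radial part of the q-invariant Laplacian, acting on sequences
`f : ℕ → ℂ` (where `f m` stands for `f(q^{2m})`):
`(Δf)(q^{2m}) = q^{-1} q^{4m} [A_m - B_m] / (q^{2m-1}−q^{2m+1})`, where
`A_m = (1−q^{2m})·(f(q^{2m-2})−f(q^{2m}))/(q^{2m-2}−q^{2m})` (set to `0` for `m = 0`) and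
`B_m = (1−q^{2m+2})·(f(q^{2m})−f(q^{2m+2}))/(q^{2m}−q^{2m+2})`. -/
noncomputable def DeltaQ (q : ℝ) (f : ℕ → ℂ) : ℕ → ℂ := fun m =>
  (q : ℂ) ^ (-1 : ℤ) * (q : ℂ) ^ (4 * (m : ℤ)) *
    ((if m = 0 then 0 else
        (1 - (q : ℂ) ^ (2 * (m : ℤ))) * (f (m - 1) - f m) /
          ((q : ℂ) ^ (2 * (m : ℤ) - 2) - (q : ℂ) ^ (2 * (m : ℤ)))) -
      (1 - (q : ℂ) ^ (2 * (m : ℤ) + 2)) * (f m - f (m + 1)) /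
        ((q : ℂ) ^ (2 * (m : ℤ)) - (q : ℂ) ^ (2 * (m : ℤ) + 2))) /
    ((q : ℂ) ^ (2 * (m : ℤ) - 1) - (q : ℂ) ^ (2 * (m : ℤ) + 1))

/-- The weighted counting measure on ℕ with `ν {m} = (1−q²) q^{-2m}`, so that
`MeasureTheory.Lp ℂ 2 (nuMeasure q)` is the Hilbert space `L²(dν)q⁰` of sequences with inner
product `⟨f,g⟩ = (1−q²) Σ_{m≥0} conj(g(q^{2m})) f(q^{2m}) q^{-2m}`. -/
noncomputable def nuMeasure (q : ℝ) : MeasureTheory.Measure ℕ :=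
  MeasureTheory.Measure.count.withDensity
    (fun m => ENNReal.ofReal ((1 - q ^ 2) * q ^ (-(2 * (m : ℤ)))))


open Filter Topology

local notation "ℓ²ℂ" => lp (fun _ : ℕ => ℂ) 2

/-- The Jacobi matrix unitarily equivalent, up to an affine change, to the radial Laplacian. -/
def jacobiSeq (q : ℝ) (g : ℕ → ℂ) (m : ℕ) : ℂ :=
  q * ((1 - (q ^ 2) ^ m) * g (m - 1) + (1 - (q ^ 2) ^ (m + 1)) * g (m + 1))
    + 2 * (q ^ 2) ^ (m + 1) * g m

lemma lp_two_memℓp_iff {f : ℕ → ℂ} :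
    Memℓp f 2 ↔ Summable fun m => ‖f m‖ ^ 2 := by
  rw [memℓp_gen_iff (by simp)]
  simp

lemma lp_two_hasSum_norm_sq (f : ℓ²ℂ) : HasSum (fun m => ‖f m‖ ^ 2) (‖f‖ ^ 2) := by
  have h := lp.hasSum_norm (p := 2) (by simp) f
  simpa using h

lemma lp_two_tendsto_zero (f : ℓ²ℂ) : Tendsto (fun m => f m) atTop (𝓝 0) := by
  have h := (lp_two_hasSum_norm_sq f).summable.tendsto_atTop_zero
  rw [tendsto_zero_iff_norm_tendsto_zero]
  have := h.sqrt
  simpa using this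

/-- The Cauchy–Schwarz step of the Schur test for a row of the Jacobi matrix. -/
lemma norm_jacobiSeq_sq_le {q : ℝ} (hq : q ∈ Set.Ioo (0 : ℝ) 1) (g : ℕ → ℂ) (m : ℕ) :
    ‖jacobiSeq q g m‖ ^ 2 ≤ 2 * q * (q * (1 - (q ^ 2) ^ m) * ‖g (m - 1)‖ ^ 2
      + 2 * (q ^ 2) ^ (m + 1) * ‖g m‖ ^ 2 + q * (1 - (q ^ 2) ^ (m + 1)) * ‖g (m + 1)‖ ^ 2) := by
  obtain ⟨h0, h1⟩ := hq
  have hp : q ^ 2 ≤ 1 := pow_le_one₀ h0.le h1.le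
  have ha : 0 ≤ q * (1 - (q ^ 2) ^ m) :=
    mul_nonneg h0.le (sub_nonneg.2 (pow_le_one₀ (by positivity) hp))
  have hc : 0 ≤ q * (1 - (q ^ 2) ^ (m + 1)) :=
    mul_nonneg h0.le (sub_nonneg.2 (pow_le_one₀ (by positivity) hp))
  have hb : 0 ≤ 2 * (q ^ 2) ^ (m + 1) := by positivity
  have hs : q * (1 - (q ^ 2) ^ m) + 2 * (q ^ 2) ^ (m + 1) + q * (1 - (q ^ 2) ^ (m + 1))
      ≤ 2 * q := by
    have : 0 ≤ (q ^ 2) ^ m * (q * (1 - q) ^ 2) := by positivity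
    rw [pow_succ (q ^ 2) m]
    nlinarith
  have hn : ‖jacobiSeq q g m‖ ≤ q * (1 - (q ^ 2) ^ m) * ‖g (m - 1)‖
      + 2 * (q ^ 2) ^ (m + 1) * ‖g m‖ + q * (1 - (q ^ 2) ^ (m + 1)) * ‖g (m + 1)‖ := by
    have e : jacobiSeq q g m = ((q * (1 - (q ^ 2) ^ m) : ℝ) : ℂ) * g (m - 1)
        + ((2 * (q ^ 2) ^ (m + 1) : ℝ) : ℂ) * g m
        + ((q * (1 - (q ^ 2) ^ (m + 1)) : ℝ) : ℂ) * g (m + 1) := by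
      simp only [jacobiSeq]; push_cast; ring
    rw [e]
    refine (norm_add₃_le).trans_eq ?_
    simp only [norm_mul, Complex.norm_real, Real.norm_of_nonneg ha, Real.norm_of_nonneg hb,
      Real.norm_of_nonneg hc]
  generalize q * (1 - (q ^ 2) ^ m) = a at *
  generalize q * (1 - (q ^ 2) ^ (m + 1)) = c at *
  generalize 2 * (q ^ 2) ^ (m + 1) = b at *
  generalize ‖g (m - 1)‖ = x at *
  generalize ‖g m‖ = y at *
  generalize ‖g (m + 1)‖ = z at *
  calc _ ≤ (a * x + b * y + c * z) ^ 2 := by gcongr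
    _ ≤ (a + b + c) * (a * x ^ 2 + b * y ^ 2 + c * z ^ 2) := by
      nlinarith [mul_nonneg (mul_nonneg ha hb) (sq_nonneg (x - y)),
        mul_nonneg (mul_nonneg ha hc) (sq_nonneg (x - z)),
        mul_nonneg (mul_nonneg hb hc) (sq_nonneg (y - z))]
    _ ≤ _ := by gcongr

lemma sum_norm_jacobiSeq_sq_le {q : ℝ} (hq : q ∈ Set.Ioo (0 : ℝ) 1) (g : ℕ → ℂ) (N : ℕ) :
    ∑ m ∈ Finset.range N, ‖jacobiSeq q g m‖ ^ 2
      ≤ (2 * q) ^ 2 * ∑ m ∈ Finset.range (N + 1), ‖g m‖ ^ 2 := by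
  have key : ∑ m ∈ Finset.range N, ‖jacobiSeq q g m‖ ^ 2
      + 2 * q * (q * (1 - (q ^ 2) ^ N) * ‖g (N - 1)‖ ^ 2)
      ≤ (2 * q) ^ 2 * ∑ m ∈ Finset.range N, ‖g m‖ ^ 2
        + 2 * q * (q * (1 - (q ^ 2) ^ N) * ‖g N‖ ^ 2) := by
    induction N with
    | zero => simp
    | succ N ih =>
      have h := norm_jacobiSeq_sq_le hq g N
      have : 0 ≤ 2 * q * ((q ^ 2) ^ N * (q * (1 - q) ^ 2) * ‖g N‖ ^ 2) := by
        have := hq.1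
        positivity
      rw [Finset.sum_range_succ, Finset.sum_range_succ, Nat.add_sub_cancel]
      rw [pow_succ (q ^ 2) N] at h ⊢
      nlinarith
  obtain ⟨h0, h1⟩ := hq
  have hN : (q ^ 2) ^ N ≤ 1 := pow_le_one₀ (by positivity) (pow_le_one₀ h0.le h1.le)
  have hN0 : 0 ≤ (q ^ 2) ^ N := by positivity
  have e1 : 0 ≤ 2 * q * (q * (1 - (q ^ 2) ^ N) * ‖g (N - 1)‖ ^ 2) := by
    have := sub_nonneg.2 hN
    positivity
  have e2 : 2 * q * (q * (1 - (q ^ 2) ^ N) * ‖g N‖ ^ 2) ≤ (2 * q) ^ 2 * ‖g N‖ ^ 2 := by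
    have : 0 ≤ 2 * q * q * ‖g N‖ ^ 2 := by positivity
    nlinarith [mul_nonneg this hN0]
  rw [Finset.sum_range_succ, mul_add]
  linarith

lemma sum_norm_jacobiSeq_sq_le_norm {q : ℝ} (hq : q ∈ Set.Ioo (0 : ℝ) 1) (g : ℓ²ℂ)
    (s : Finset ℕ) : ∑ m ∈ s, ‖jacobiSeq q g m‖ ^ 2 ≤ (2 * q * ‖g‖) ^ 2 := by
  obtain ⟨N, hN⟩ := s.exists_nat_subset_range
  calc _ ≤ ∑ m ∈ Finset.range N, ‖jacobiSeq q g m‖ ^ 2 :=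
        Finset.sum_le_sum_of_subset_of_nonneg hN fun _ _ _ => by positivity
    _ ≤ _ := sum_norm_jacobiSeq_sq_le hq g N
    _ ≤ (2 * q) ^ 2 * ‖g‖ ^ 2 := by
        gcongr
        exact sum_le_hasSum _ (fun _ _ => by positivity) (lp_two_hasSum_norm_sq g)
    _ = _ := by ring

lemma memℓp_jacobiSeq {q : ℝ} (hq : q ∈ Set.Ioo (0 : ℝ) 1) (g : ℓ²ℂ) :
    Memℓp (jacobiSeq q g) 2 :=
  memℓp_gen' (C := (2 * q * ‖g‖) ^ 2) fun s => by
    simpa using sum_norm_jacobiSeq_sq_le_norm hq g s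

/-- Green's formula for the Jacobi matrix. -/
lemma sum_inner_jacobiSeq_sub (q : ℝ) (f g : ℕ → ℂ) (N : ℕ) :
    ∑ m ∈ Finset.range N, (inner ℂ (jacobiSeq q f m) (g m) - inner ℂ (f m) (jacobiSeq q g m))
      = q * (1 - (q ^ 2) ^ N)
        * (inner ℂ (f N) (g (N - 1)) - inner ℂ (f (N - 1)) (g N)) := by
  induction N with
  | zero => simp
  | succ N ih =>
    rw [Finset.sum_range_succ, ih]
    simp only [jacobiSeq, RCLike.inner_apply, map_add, map_mul, map_sub, map_one, map_pow,
      Complex.conj_ofReal, Nat.add_sub_cancel, map_ofNat]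
    ring

/-- A virial identity: any real solution of the Jacobi recurrence satisfies it exactly. -/
lemma jacobi_virial (q t : ℝ) (x : ℕ → ℝ)
    (h : ∀ m, (1 - (q ^ 2) ^ m) * x (m - 1) + (1 - (q ^ 2) ^ (m + 1)) * x (m + 1)
      + 2 * q * (q ^ 2) ^ m * x m = t * x m) (N : ℕ) :
    (1 - (q ^ 2) ^ (N + 1)) ^ 2 * x (N + 1) ^ 2 + (1 - (q ^ 2) ^ N) ^ 2 * x N ^ 2
      - (t - 2 * q * (q ^ 2) ^ N) * (1 - (q ^ 2) ^ (N + 1)) * x N * x (N + 1)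
      + (1 - q ^ 2) * (1 - (q ^ 2) ^ N) * (q ^ 2) ^ N * x N ^ 2
      = (1 - q ^ 2) * ∑ k ∈ Finset.range N,
          (1 - (q ^ 2) ^ (k + 1)) * (q ^ 2) ^ k * (x k - q * x (k + 1)) ^ 2 := by
  induction N with
  | zero =>
    have := h 0
    simp at this ⊢
    linear_combination (1 - q ^ 2) * x 1 * this
  | succ N ih =>
    have := h (N + 1)
    rw [Finset.sum_range_succ, mul_add, ← ih]
    simp only [Nat.add_sub_cancel] at this
    rw [pow_succ _ (N + 1)] at this ⊢
    rw [pow_succ _ N] at this ⊢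
    generalize (q ^ 2) ^ N = P at *
    linear_combination ((1 - P * q ^ 2 * q ^ 2) * x (N + 1 + 1) - (1 - P * q ^ 2) * x N) * this

lemma jacobi_real_solution_eq_zero {q : ℝ} (hq : q ∈ Set.Ioo (0 : ℝ) 1) (t : ℝ) (x : ℕ → ℝ)
    (h : ∀ m, (1 - (q ^ 2) ^ m) * x (m - 1) + (1 - (q ^ 2) ^ (m + 1)) * x (m + 1)
      + 2 * q * (q ^ 2) ^ m * x m = t * x m) (hx : Tendsto x atTop (𝓝 0)) (m : ℕ) : x m = 0 := by
  obtain ⟨h0, h1⟩ := hq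
  have hp1 : q ^ 2 < 1 := pow_lt_one₀ h0.le h1 two_ne_zero
  have hp : Tendsto (fun N : ℕ => (q ^ 2) ^ N) atTop (𝓝 0) :=
    tendsto_pow_atTop_nhds_zero_of_lt_one (by positivity) hp1
  have hp' := hp.comp (tendsto_add_atTop_nat 1)
  have hx' := hx.comp (tendsto_add_atTop_nat 1)
  have hpos (k : ℕ) : 0 < (1 - (q ^ 2) ^ (k + 1)) * (q ^ 2) ^ k :=
    mul_pos (sub_pos.2 (pow_lt_one₀ (by positivity) hp1 (by simp))) (by positivity)
  have hlim : Tendsto (fun N => (1 - q ^ 2) * ∑ k ∈ Finset.range N,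
      (1 - (q ^ 2) ^ (k + 1)) * (q ^ 2) ^ k * (x k - q * x (k + 1)) ^ 2) atTop (𝓝 0) := by
    simp_rw [← jacobi_virial q t x h]
    have := (((((hp'.const_sub 1).pow 2).mul (hx'.pow 2)).add
      (((hp.const_sub 1).pow 2).mul (hx.pow 2))).sub
      ((((hp.const_mul (2 * q)).const_sub t).mul (hp'.const_sub 1)).mul hx |>.mul hx')).add
      ((((hp.const_sub 1).const_mul (1 - q ^ 2)).mul hp).mul (hx.pow 2))
    simpa using this
  have hstep (k : ℕ) : x k = q * x (k + 1) := by
    have hle : (1 - q ^ 2) * ((1 - (q ^ 2) ^ (k + 1)) * (q ^ 2) ^ k * (x k - q * x (k + 1)) ^ 2)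
        ≤ 0 := by
      refine ge_of_tendsto hlim ?_
      filter_upwards [eventually_ge_atTop (k + 1)] with N hN
      refine mul_le_mul_of_nonneg_left ?_ (sub_nonneg.2 hp1.le)
      exact Finset.single_le_sum
        (f := fun k => (1 - (q ^ 2) ^ (k + 1)) * (q ^ 2) ^ k * (x k - q * x (k + 1)) ^ 2)
        (fun i _ => mul_nonneg (hpos i).le (sq_nonneg _)) (Finset.mem_range.2 hN)
    have hc := mul_pos (sub_pos.2 hp1) (hpos k)
    rw [← mul_assoc] at hle
    have := (mul_nonpos_iff_pos_imp_nonpos.1 hle).1 hc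
    exact sub_eq_zero.1 (pow_eq_zero_iff two_ne_zero |>.1 (le_antisymm this (sq_nonneg _)))
  have hpow (n : ℕ) : x m = q ^ n * x (m + n) := by
    induction n with
    | zero => simp
    | succ n ih => rw [ih, hstep (m + n), pow_succ, add_assoc, mul_assoc]
  have := (tendsto_pow_atTop_nhds_zero_of_lt_one h0.le h1).mul
    (hx.comp (tendsto_add_atTop_nat m))
  refine tendsto_nhds_unique (tendsto_const_nhds (x := x m) (f := atTop (α := ℕ))) ?_
  rw [mul_zero] at this
  refine this.congr fun n => ?_
  rw [hpow n, Function.comp, add_comm]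

/-- The Jacobi matrix as a bounded operator on `ℓ²`. -/
def jacobiOp (q : ℝ) (hq : q ∈ Set.Ioo (0 : ℝ) 1) : ℓ²ℂ →L[ℂ] ℓ²ℂ :=
  LinearMap.mkContinuous
    { toFun g := ⟨jacobiSeq q g, memℓp_jacobiSeq hq g⟩
      map_add' f g := by
        ext m
        simp only [jacobiSeq, lp.coeFn_add, Pi.add_apply]
        ring
      map_smul' c g := by
        ext m
        simp only [jacobiSeq, lp.coeFn_smul, Pi.smul_apply, smul_eq_mul, RingHom.id_apply]
        ring }
    (2 * q) fun g => lp.norm_le_of_forall_sum_le (by simp)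
      (mul_nonneg (by linarith [hq.1]) (norm_nonneg g)) fun s => by
        simpa using sum_norm_jacobiSeq_sq_le_norm hq g s

section jacobiOp

variable {q : ℝ} (hq : q ∈ Set.Ioo (0 : ℝ) 1)

lemma jacobiOp_apply (g : ℓ²ℂ) (m : ℕ) : jacobiOp q hq g m = jacobiSeq q g m := rfl

lemma norm_jacobiOp_le : ‖jacobiOp q hq‖ ≤ 2 * q :=
  LinearMap.mkContinuous_norm_le _ (by linarith [hq.1]) _

lemma isSelfAdjoint_jacobiOp : IsSelfAdjoint (jacobiOp q hq) := by
  rw [ContinuousLinearMap.isSelfAdjoint_iff_isSymmetric]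
  intro f g
  have h1 : HasSum (fun m => inner ℂ (jacobiSeq q f m) (g m)) (inner ℂ (jacobiOp q hq f) g) :=
    lp.hasSum_inner (jacobiOp q hq f) g
  have h2 : HasSum (fun m => inner ℂ (f m) (jacobiSeq q g m)) (inner ℂ f (jacobiOp q hq g)) :=
    lp.hasSum_inner f (jacobiOp q hq g)
  have h := (h1.sub h2).tendsto_sum_nat
  simp only [sum_inner_jacobiSeq_sub] at h
  have hp : Tendsto (fun N : ℕ => ((q : ℂ) ^ 2) ^ N) atTop (𝓝 0) := by
    refine tendsto_pow_atTop_nhds_zero_of_norm_lt_one ?_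
    rw [norm_pow, Complex.norm_real, Real.norm_of_nonneg hq.1.le]
    exact pow_lt_one₀ hq.1.le hq.2 two_ne_zero
  have hf := lp_two_tendsto_zero f
  have hg := lp_two_tendsto_zero g
  have hf' := hf.comp (tendsto_sub_atTop_nat 1)
  have hg' := hg.comp (tendsto_sub_atTop_nat 1)
  have h0 := ((tendsto_const_nhds (x := (q : ℂ))).mul (hp.const_sub 1)).mul
    ((hf.inner (𝕜 := ℂ) hg').sub (hf'.inner (𝕜 := ℂ) hg))
  simp only [inner_zero_left, sub_zero, mul_zero] at h0
  exact sub_eq_zero.1 (tendsto_nhds_unique h h0)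

lemma jacobiOp_eigenvector_eq_zero (c : ℂ) (g : ℓ²ℂ) (h : jacobiOp q hq g = c • g) : g = 0 := by
  by_contra hg
  have hc : (starRingEnd ℂ) c = c :=
    ((isSelfAdjoint_jacobiOp hq).isSymmetric).conj_eigenvalue_eq_self
      (Module.End.hasEigenvalue_of_hasEigenvector
        (Module.End.hasEigenvector_iff.2 ⟨Module.End.mem_eigenspace_iff.2 h, hg⟩))
  obtain ⟨r, rfl⟩ := Complex.conj_eq_iff_real.1 hc
  have hq0 : (q : ℂ) ≠ 0 := Complex.ofReal_ne_zero.2 hq.1.ne'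
  have hrec (m : ℕ) : ((1 - (q ^ 2) ^ m : ℝ) : ℂ) * g (m - 1)
      + ((1 - (q ^ 2) ^ (m + 1) : ℝ) : ℂ) * g (m + 1)
      + ((2 * q * (q ^ 2) ^ m : ℝ) : ℂ) * g m = ((r / q : ℝ) : ℂ) * g m := by
    have := congrArg (fun f : ℓ²ℂ => f m) h
    simp only [jacobiOp_apply, jacobiSeq, lp.coeFn_smul, Pi.smul_apply, smul_eq_mul] at this
    push_cast
    field_simp
    linear_combination this
  have hlim := lp_two_tendsto_zero g
  refine hg (lp.ext (funext fun m => Complex.ext ?_ ?_))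
  · refine jacobi_real_solution_eq_zero hq (r / q) (fun m => (g m).re) (fun m => ?_) ?_ m
    · simpa only [Complex.add_re, Complex.re_ofReal_mul] using congrArg Complex.re (hrec m)
    · exact (Complex.continuous_re.tendsto 0).comp hlim
  · refine jacobi_real_solution_eq_zero hq (r / q) (fun m => (g m).im) (fun m => ?_) ?_ m
    · simpa only [Complex.add_im, Complex.im_ofReal_mul] using congrArg Complex.im (hrec m)
    · exact (Complex.continuous_im.tendsto 0).comp hlim


lemma summable_norm_pow_sq {z : ℂ} (hz : ‖z‖ < 1) : Summable fun m : ℕ => ‖z ^ m‖ ^ 2 := by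
  simp_rw [norm_pow, ← pow_mul, mul_comm _ 2, pow_mul]
  exact summable_geometric_of_lt_one (by positivity) (pow_lt_one₀ (norm_nonneg z) hz two_ne_zero)

/-- The geometric sequence `m ↦ z ^ m` as an element of `ℓ²`. -/
def geomSeq (z : ℂ) (hz : ‖z‖ < 1) : ℓ²ℂ :=
  ⟨fun m => z ^ m, lp_two_memℓp_iff.2 (summable_norm_pow_sq hz)⟩

lemma geomSeq_apply (z : ℂ) (hz : ‖z‖ < 1) (m : ℕ) : geomSeq z hz m = z ^ m := rfl

lemma norm_geomSeq_sq (z : ℂ) (hz : ‖z‖ < 1) : ‖geomSeq z hz‖ ^ 2 = (1 - ‖z‖ ^ 2)⁻¹ := by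
  refine (lp_two_hasSum_norm_sq (geomSeq z hz)).unique ?_
  simp_rw [geomSeq_apply, norm_pow, ← pow_mul, mul_comm _ 2, pow_mul]
  exact hasSum_geometric_of_lt_one (by positivity) (pow_lt_one₀ (norm_nonneg z) hz two_ne_zero)

lemma jacobiOp_geomSeq (z : ℂ) (hz0 : z ≠ 0) (hz : ‖z‖ < 1) (hz' : ‖(q : ℂ) ^ 2 * z‖ < 1) :
    jacobiOp q hq (geomSeq z hz) = (q * (z + z⁻¹)) • geomSeq z hz
      - (q * z⁻¹ * (1 - q * z) ^ 2) • geomSeq (q ^ 2 * z) hz' := by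
  ext m
  simp only [jacobiOp_apply, jacobiSeq, lp.coeFn_sub, lp.coeFn_smul, Pi.sub_apply, Pi.smul_apply,
    geomSeq_apply, smul_eq_mul]
  rcases m with - | m
  · simp
    field_simp
    ring
  · rw [Nat.add_sub_cancel, mul_pow]
    field_simp
    ring

lemma mem_spectrum_jacobiOp {t : ℝ} (ht : t ∈ Set.Icc (-(2 * q)) (2 * q)) :
    (t : ℂ) ∈ spectrum ℂ (jacobiOp q hq) := by
  obtain ⟨h0, h1⟩ := id hq
  intro hunit
  obtain ⟨R, hR⟩ := hunit.exists_left_inv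
  set e : ℂ := Complex.exp (Real.arccos (t / (2 * q)) * Complex.I) with he
  have he0 : e ≠ 0 := Complex.exp_ne_zero _
  have hen : ‖e‖ = 1 := Complex.norm_exp_ofReal_mul_I _
  have het : q * (e + e⁻¹) = t := by
    have h2 : (2 : ℂ) * Complex.cos (Real.arccos (t / (2 * q))) = e + e⁻¹ := by
      rw [Complex.two_cos, he, ← Complex.exp_neg, neg_mul]
    rw [← h2, ← Complex.ofReal_cos, Real.cos_arccos]
    · push_cast
      field_simp [Complex.ofReal_ne_zero.2 h0.ne']
    · rw [le_div_iff₀ (by positivity)]; linarith [ht.1]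
    · rw [div_le_iff₀ (by positivity)]; linarith [ht.2]
  let C : ℝ → ℝ := fun r => ‖R‖ * (‖(t : ℂ) - q * (r * e + (r * e)⁻¹)‖
    + ‖q * (r * e)⁻¹ * (1 - q * (r * e)) ^ 2‖ * √((1 - r ^ 2) / (1 - (q ^ 2 * r) ^ 2)))
  have hC1 : C 1 = 0 := by simp [C, het]
  have hq4 : 1 - (q ^ 2 * 1) ^ 2 ≠ 0 := by
    have : (q ^ 2 * 1) ^ 2 < 1 := by
      rw [mul_one, ← pow_mul]
      exact pow_lt_one₀ h0.le h1 (by simp)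
    linarith
  have hcont : ContinuousAt C 1 := by
    have hne : ((1 : ℝ) : ℂ) * e ≠ 0 := by simpa using he0
    fun_prop (disch := assumption)
  have hge : ∀ r ∈ Set.Ioo (0 : ℝ) 1, 1 ≤ C r := by
    rintro r ⟨hr0, hr1⟩
    have hn : ‖(r : ℂ) * e‖ = r := by
      rw [norm_mul, hen, mul_one, Complex.norm_real, Real.norm_of_nonneg hr0.le]
    have hn' : ‖(q : ℂ) ^ 2 * (r * e)‖ = q ^ 2 * r := by
      rw [norm_mul, hn, norm_pow, Complex.norm_real, Real.norm_of_nonneg h0.le]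
    have hz : ‖(r : ℂ) * e‖ < 1 := hn.trans_lt hr1
    have hz' : ‖(q : ℂ) ^ 2 * (r * e)‖ < 1 := by
      rw [hn']
      exact mul_lt_one_of_nonneg_of_lt_one_left (by positivity) (pow_lt_one₀ h0.le h1 two_ne_zero)
        hr1.le
    have hz0 : (r : ℂ) * e ≠ 0 := mul_ne_zero (Complex.ofReal_ne_zero.2 hr0.ne') he0
    set g := geomSeq (r * e) hz with hg
    set g' := geomSeq (q ^ 2 * (r * e)) hz' with hg'
    have hRg : R (((t : ℂ) - q * (r * e + (r * e)⁻¹)) • g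
        + (q * (r * e)⁻¹ * (1 - q * (r * e)) ^ 2) • g') = g := by
      have h := congrArg (fun A : ℓ²ℂ →L[ℂ] ℓ²ℂ => A g) hR
      simp only [mul_apply_eq_comp, sub_apply, one_apply_eq_self,
        Algebra.algebraMap_eq_smul_one, smul_apply] at h
      rw [hg, jacobiOp_geomSeq hq _ hz0 hz hz'] at h
      rw [hg, hg']
      refine Eq.trans ?_ h
      congr 1
      module
    have hgn : ‖g‖ = √((1 - r ^ 2)⁻¹) := by
      rw [← Real.sqrt_sq (norm_nonneg g), norm_geomSeq_sq, hn]
    have hgn' : ‖g'‖ = √((1 - (q ^ 2 * r) ^ 2)⁻¹) := by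
      rw [← Real.sqrt_sq (norm_nonneg g'), norm_geomSeq_sq, hn']
    have hr2 : 0 < 1 - r ^ 2 := sub_pos.2 (pow_lt_one₀ hr0.le hr1 two_ne_zero)
    have hgpos : 0 < ‖g‖ := by rw [hgn]; positivity
    have hquot : √((1 - r ^ 2) / (1 - (q ^ 2 * r) ^ 2)) * ‖g‖ = ‖g'‖ := by
      rw [hgn, hgn', ← Real.sqrt_mul' _ (by positivity)]
      congr 1
      field_simp
    refine le_of_mul_le_mul_right ?_ hgpos
    calc 1 * ‖g‖ = ‖R (((t : ℂ) - q * (r * e + (r * e)⁻¹)) • g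
          + (q * (r * e)⁻¹ * (1 - q * (r * e)) ^ 2) • g')‖ := by rw [hRg, one_mul]
      _ ≤ ‖R‖ * (‖((t : ℂ) - q * (r * e + (r * e)⁻¹))‖ * ‖g‖
          + ‖q * (r * e)⁻¹ * (1 - q * (r * e)) ^ 2‖ * ‖g'‖) := by
          refine (R.le_opNorm _).trans ?_
          gcongr
          refine (norm_add_le _ _).trans_eq ?_
          rw [norm_smul, norm_smul]
      _ = C r * ‖g‖ := by rw [← hquot]; ring
  have hlim : Tendsto C (𝓝[<] 1) (𝓝 0) := hC1 ▸ hcont.tendsto.mono_left nhdsWithin_le_nhds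
  have := ge_of_tendsto hlim (Filter.mem_of_superset (Ioo_mem_nhdsLT one_pos) hge)
  linarith

lemma spectrum_jacobiOp :
    spectrum ℂ (jacobiOp q hq) = Complex.ofReal '' Set.Icc (-(2 * q)) (2 * q) := by
  refine Set.Subset.antisymm (fun c hc => ?_) ?_
  · have hre := (isSelfAdjoint_jacobiOp hq).mem_spectrum_eq_re hc
    refine ⟨c.re, ?_, hre.symm⟩
    rw [Set.mem_Icc, ← abs_le]
    exact (Complex.abs_re_le_norm c).trans
      ((spectrum.norm_le_norm_mul_of_mem hc).trans ((mul_le_of_le_one_right (norm_nonneg _)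
        ContinuousLinearMap.norm_id_le).trans (norm_jacobiOp_le hq)))
  · rintro _ ⟨t, ht, rfl⟩
    exact mem_spectrum_jacobiOp hq ht

end jacobiOp

section nuMeasure

open MeasureTheory

/-- The square root of the `nuMeasure` of the point `m`. -/
def nuWeight (q : ℝ) (m : ℕ) : ℝ := √(1 - q ^ 2) * (q ^ m)⁻¹

lemma nuWeight_pos {q : ℝ} (hq : q ∈ Set.Ioo (0 : ℝ) 1) (m : ℕ) : 0 < nuWeight q m :=
  mul_pos (Real.sqrt_pos.2 (sub_pos.2 (pow_lt_one₀ hq.1.le hq.2 two_ne_zero)))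
    (inv_pos.2 (pow_pos hq.1 m))

lemma nuWeight_sq {q : ℝ} (hq : q ∈ Set.Ioo (0 : ℝ) 1) (m : ℕ) :
    nuWeight q m ^ 2 = (1 - q ^ 2) * q ^ (-(2 * (m : ℤ))) := by
  have : q ^ 2 < 1 := pow_lt_one₀ hq.1.le hq.2 two_ne_zero
  rw [nuWeight, mul_pow, Real.sq_sqrt (by linarith), zpow_neg, inv_pow, ← pow_mul, mul_comm m 2]
  norm_cast

lemma nuWeight_succ {q : ℝ} (hq : q ∈ Set.Ioo (0 : ℝ) 1) (m : ℕ) :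
    nuWeight q m = q * nuWeight q (m + 1) := by
  have := hq.1.ne'
  simp only [nuWeight, pow_succ]
  field_simp

lemma ae_nuMeasure_iff {q : ℝ} (hq : q ∈ Set.Ioo (0 : ℝ) 1) {P : ℕ → Prop} :
    (∀ᵐ m ∂nuMeasure q, P m) ↔ ∀ m, P m := by
  rw [nuMeasure, ae_withDensity_iff (measurable_of_countable _), Measure.ae_count_iff]
  refine forall_congr' fun m => imp_iff_right ?_
  rw [← nuWeight_sq hq]
  simpa using (nuWeight_pos hq m).ne'

lemma lintegral_nuMeasure_enorm_sq {q : ℝ} (hq : q ∈ Set.Ioo (0 : ℝ) 1) (f : ℕ → ℂ) :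
    ∫⁻ m, ‖f m‖ₑ ^ 2 ∂nuMeasure q = ∑' m, ENNReal.ofReal (‖nuWeight q m * f m‖ ^ 2) := by
  rw [nuMeasure, lintegral_withDensity_eq_lintegral_mul _ (measurable_of_countable _)
    (measurable_of_countable _), lintegral_count]
  refine tsum_congr fun m => ?_
  rw [Pi.mul_apply, ← nuWeight_sq hq, norm_mul, mul_pow, ENNReal.ofReal_mul (by positivity),
    Complex.norm_real, Real.norm_eq_abs, sq_abs, ENNReal.ofReal_pow (norm_nonneg _), ofReal_norm]

lemma memLp_nuMeasure_iff {q : ℝ} (hq : q ∈ Set.Ioo (0 : ℝ) 1) {f : ℕ → ℂ} :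
    MemLp f 2 (nuMeasure q) ↔ Memℓp (fun m => nuWeight q m * f m) 2 := by
  have hm : AEStronglyMeasurable f (nuMeasure q) :=
    (measurable_of_countable f).aestronglyMeasurable
  rw [MemLp, and_iff_right hm,
    eLpNorm_lt_top_iff_lintegral_rpow_enorm_lt_top two_ne_zero ENNReal.ofNat_ne_top,
    lp_two_memℓp_iff]
  simp only [ENNReal.toReal_ofNat, ENNReal.rpow_ofNat]
  rw [lintegral_nuMeasure_enorm_sq hq]
  refine ⟨fun h => ?_, fun h => h.tsum_ofReal_lt_top⟩
  exact (summable_congr fun m => ENNReal.toReal_ofReal (by positivity)).1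
    (ENNReal.summable_toReal h.ne)

/-- Multiplication by `nuWeight` identifies `L²(ν)` with `ℓ²`. -/
def nuToEllTwo {q : ℝ} (hq : q ∈ Set.Ioo (0 : ℝ) 1) : Lp ℂ 2 (nuMeasure q) ≃ₗᵢ[ℂ] ℓ²ℂ :=
  LinearIsometryEquiv.ofSurjective
    { toFun f := ⟨fun m => nuWeight q m * f m, (memLp_nuMeasure_iff hq).1 (Lp.memLp f)⟩
      map_add' f g := by
        ext m
        have := (ae_nuMeasure_iff hq).1 (Lp.coeFn_add f g) m
        simp only [this, lp.coeFn_add, Pi.add_apply]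
        ring
      map_smul' c f := by
        ext m
        have := (ae_nuMeasure_iff hq).1 (Lp.coeFn_smul c f) m
        simp only [this, lp.coeFn_smul, Pi.smul_apply, smul_eq_mul, RingHom.id_apply]
        ring
      norm_map' f := by
        have h := lp_two_hasSum_norm_sq
          ⟨fun m => nuWeight q m * f m, (memLp_nuMeasure_iff hq).1 (Lp.memLp f)⟩
        refine (sq_eq_sq₀ (norm_nonneg _) (norm_nonneg _)).1 ?_
        refine Eq.trans h.tsum_eq.symm ?_
        have hi := lintegral_nuMeasure_enorm_sq hq f
        rw [← ENNReal.ofReal_tsum_of_nonneg (fun _ => by positivity) h.summable] at hi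
        rw [Lp.norm_def, eLpNorm_eq_lintegral_rpow_enorm_toReal two_ne_zero ENNReal.ofNat_ne_top]
        simp only [ENNReal.toReal_ofNat, ENNReal.rpow_ofNat]
        rw [hi, ENNReal.ofReal_rpow_of_nonneg (tsum_nonneg fun _ => by positivity) (by positivity),
          ENNReal.toReal_ofReal (by positivity), ← Real.sqrt_eq_rpow,
          Real.sq_sqrt (tsum_nonneg fun _ => by positivity)] }
    fun g => by
      have hw (m : ℕ) : (nuWeight q m : ℂ) * ((nuWeight q m : ℂ)⁻¹ * g m) = g m :=
        mul_inv_cancel_left₀ (Complex.ofReal_ne_zero.2 (nuWeight_pos hq m).ne') _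
      have hg : MemLp (fun m => (nuWeight q m : ℂ)⁻¹ * g m) 2 (nuMeasure q) := by
        rw [memLp_nuMeasure_iff hq]
        simpa only [hw] using lp.memℓp g
      refine ⟨hg.toLp, ?_⟩
      ext m
      have := (ae_nuMeasure_iff hq).1 hg.coeFn_toLp m
      exact (congrArg _ this).trans (hw m)

lemma nuToEllTwo_apply {q : ℝ} (hq : q ∈ Set.Ioo (0 : ℝ) 1) (f : Lp ℂ 2 (nuMeasure q)) (m : ℕ) :
    nuToEllTwo hq f m = nuWeight q m * f m := rfl

lemma DeltaQ_eq {q : ℝ} (hq : q ∈ Set.Ioo (0 : ℝ) 1) (f : ℕ → ℂ) (m : ℕ) :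
    DeltaQ q f m = (((1 - q ^ 2) ^ 2)⁻¹ : ℝ) * (q ^ 2 * (1 - (q ^ 2) ^ m) * f (m - 1)
      + (1 - (q ^ 2) ^ (m + 1)) * f (m + 1) + 2 * (q ^ 2) ^ (m + 1) * f m
      - (1 + q ^ 2) * f m) := by
  have h0 : (q : ℂ) ≠ 0 := Complex.ofReal_ne_zero.2 hq.1.ne'
  have h1 : (1 - (q : ℂ) ^ 2) ≠ 0 := by
    have : 1 - q ^ 2 ≠ 0 := (sub_pos.2 (pow_lt_one₀ hq.1.le hq.2 two_ne_zero)).ne'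
    exact_mod_cast Complex.ofReal_ne_zero.2 this
  have e1 : (q : ℂ) ^ (4 * (m : ℤ)) = ((q ^ 2) ^ m) ^ 2 := by
    rw [← pow_mul, ← pow_mul, ← zpow_natCast]; congr 1; push_cast; ring
  have e2 : (q : ℂ) ^ (2 * (m : ℤ)) = (q ^ 2) ^ m := by
    rw [← pow_mul, ← zpow_natCast]; congr 1
  have e3 : (q : ℂ) ^ (2 * (m : ℤ) - 2) = (q ^ 2) ^ m / q ^ 2 := by
    rw [zpow_sub₀ h0, e2]; norm_cast
  have e4 : (q : ℂ) ^ (2 * (m : ℤ) + 2) = (q ^ 2) ^ m * q ^ 2 := by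
    rw [zpow_add₀ h0, e2]; norm_cast
  have e5 : (q : ℂ) ^ (2 * (m : ℤ) - 1) = (q ^ 2) ^ m / q := by
    rw [zpow_sub_one₀ h0, e2, div_eq_mul_inv]
  have e6 : (q : ℂ) ^ (2 * (m : ℤ) + 1) = (q ^ 2) ^ m * q := by
    rw [zpow_add_one₀ h0, e2]
  have hP : ((q : ℂ) ^ 2) ^ m ≠ 0 := pow_ne_zero _ (pow_ne_zero _ h0)
  have hif : (if m = 0 then 0 else (1 - ((q : ℂ) ^ 2) ^ m) * (f (m - 1) - f m) /
      ((q ^ 2) ^ m / q ^ 2 - (q ^ 2) ^ m)) = (1 - ((q : ℂ) ^ 2) ^ m) * (f (m - 1) - f m) /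
      ((q ^ 2) ^ m / q ^ 2 - (q ^ 2) ^ m) := by
    split_ifs with h
    · simp [h]
    · rfl
  simp only [DeltaQ, e1, e2, e3, e4, e5, e6, hif, zpow_neg_one]
  rw [pow_succ ((q : ℂ) ^ 2) m]
  generalize ((q : ℂ) ^ 2) ^ m = P at *
  have d1 : P / (q : ℂ) ^ 2 - P = P * (1 - q ^ 2) / q ^ 2 := by field_simp
  have d2 : P - P * (q : ℂ) ^ 2 = P * (1 - q ^ 2) := by ring
  have d3 : P / (q : ℂ) - P * q = P * (1 - q ^ 2) / q := by field_simp
  rw [d1, d2, d3]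
  push_cast
  field_simp
  ring

lemma nuWeight_mul_DeltaQ {q : ℝ} (hq : q ∈ Set.Ioo (0 : ℝ) 1) (f : ℕ → ℂ) (m : ℕ) :
    nuWeight q m * DeltaQ q f m = (((1 - q ^ 2) ^ 2)⁻¹ : ℝ)
      * (jacobiSeq q (fun k => nuWeight q k * f k) m - (1 + q ^ 2) * (nuWeight q m * f m)) := by
  rw [DeltaQ_eq hq]
  have h (k : ℕ) : (nuWeight q k : ℂ) = q * nuWeight q (k + 1) := by
    exact_mod_cast congrArg Complex.ofReal (nuWeight_succ hq k)
  simp only [jacobiSeq]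
  rcases m with - | m
  · rw [h 0]
    simp
    ring
  · simp only [Nat.add_sub_cancel]
    rw [h m, h (m + 1)]
    ring

lemma ofReal_mul_image_Icc_sub {k : ℝ} (hk : 0 < k) (a b c : ℝ) :
    (fun z : ℂ => (k : ℂ) * (z - c)) '' (Complex.ofReal '' Set.Icc a b)
      = Complex.ofReal '' Set.Icc (k * (a - c)) (k * (b - c)) := by
  ext z
  simp only [Set.mem_image, exists_exists_and_eq_and, Set.mem_Icc]
  constructor
  · rintro ⟨t, ⟨h1, h2⟩, rfl⟩
    exact ⟨k * (t - c), ⟨by gcongr, by gcongr⟩, by push_cast; rfl⟩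
  · rintro ⟨t, ⟨h1, h2⟩, rfl⟩
    refine ⟨t / k + c, ⟨?_, ?_⟩, ?_⟩
    · rw [← sub_le_iff_le_add, le_div_iff₀' hk]; exact h1
    · rw [← le_sub_iff_add_le, div_le_iff₀' hk]; exact h2
    · have : (k : ℂ) ≠ 0 := Complex.ofReal_ne_zero.2 hk.ne'
      push_cast
      field_simp
      ring

lemma spectrum_smul_sub_algebraMap {A : Type*} [Ring A] [Algebra ℂ A] {k : ℂ} (hk : k ≠ 0)
    (c : ℂ) (a : A) :
    spectrum ℂ (k • (a - algebraMap ℂ A c)) = (fun z => k * (z - c)) '' spectrum ℂ a := by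
  have h := spectrum.unit_smul_eq_smul (a - algebraMap ℂ A c) (Units.mk0 k hk)
  rw [← spectrum.sub_singleton_eq] at h
  refine h.trans ?_
  rw [Set.sub_singleton, ← Set.image_smul, Set.image_image]
  rfl

/-- The radial Laplacian as a bounded operator on `L²(ν)`. -/
def DeltaQOp {q : ℝ} (hq : q ∈ Set.Ioo (0 : ℝ) 1) :
    Lp ℂ 2 (nuMeasure q) →L[ℂ] Lp ℂ 2 (nuMeasure q) :=
  (nuToEllTwo hq).toContinuousLinearEquiv.conjContinuousAlgEquiv.symm
    (((((1 - q ^ 2) ^ 2)⁻¹ : ℝ) : ℂ) •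
      (jacobiOp q hq - algebraMap ℂ _ (((1 + q ^ 2 : ℝ) : ℂ))))

lemma nuToEllTwo_DeltaQOp {q : ℝ} (hq : q ∈ Set.Ioo (0 : ℝ) 1) (f : Lp ℂ 2 (nuMeasure q)) :
    nuToEllTwo hq (DeltaQOp hq f) = ((((1 - q ^ 2) ^ 2)⁻¹ : ℝ) : ℂ) •
      (jacobiOp q hq (nuToEllTwo hq f) - ((1 + q ^ 2 : ℝ) : ℂ) • nuToEllTwo hq f) :=
  (nuToEllTwo hq).apply_symm_apply _

lemma DeltaQOp_apply {q : ℝ} (hq : q ∈ Set.Ioo (0 : ℝ) 1) (f : Lp ℂ 2 (nuMeasure q)) (m : ℕ) :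
    DeltaQOp hq f m = DeltaQ q f m := by
  have hw : (nuWeight q m : ℂ) ≠ 0 := Complex.ofReal_ne_zero.2 (nuWeight_pos hq m).ne'
  refine mul_left_cancel₀ hw ?_
  rw [← nuToEllTwo_apply hq, nuToEllTwo_DeltaQOp, nuWeight_mul_DeltaQ hq]
  simp only [lp.coeFn_smul, lp.coeFn_sub, Pi.smul_apply, Pi.sub_apply, smul_eq_mul,
    nuToEllTwo_apply, jacobiOp_apply]
  push_cast
  rfl

lemma spectrum_DeltaQOp {q : ℝ} (hq : q ∈ Set.Ioo (0 : ℝ) 1) : spectrum ℂ (DeltaQOp hq)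
    = Complex.ofReal '' Set.Icc (-(1 / (1 - q) ^ 2)) (-(1 / (1 + q) ^ 2)) := by
  have hq1 : 0 < 1 - q := sub_pos.2 hq.2
  have hq2 : 0 < 1 + q := by linarith [hq.1]
  have hf : 1 - q ^ 2 = (1 - q) * (1 + q) := by ring
  have hk : 0 < ((1 - q ^ 2) ^ 2)⁻¹ := by rw [hf]; positivity
  rw [DeltaQOp, AlgEquiv.spectrum_eq, spectrum_smul_sub_algebraMap
    (Complex.ofReal_ne_zero.2 hk.ne'), spectrum_jacobiOp, ofReal_mul_image_Icc_sub hk]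
  congr 2
  · rw [hf]
    field_simp
    ring
  · rw [hf]
    field_simp
    ring

lemma DeltaQOp_eigenvector_eq_zero {q : ℝ} (hq : q ∈ Set.Ioo (0 : ℝ) 1) (c : ℂ)
    (f : Lp ℂ 2 (nuMeasure q))
    (h : DeltaQOp hq f = c • f) : f = 0 := by
  have hk : ((((1 - q ^ 2) ^ 2)⁻¹ : ℝ) : ℂ) ≠ 0 :=
    Complex.ofReal_ne_zero.2 (inv_ne_zero (pow_ne_zero 2
      (sub_pos.2 (pow_lt_one₀ hq.1.le hq.2 two_ne_zero)).ne'))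
  have h' := nuToEllTwo_DeltaQOp hq f
  rw [h, map_smul] at h'
  refine (nuToEllTwo hq).map_eq_zero_iff.1 (jacobiOp_eigenvector_eq_zero hq
    (((((1 - q ^ 2) ^ 2)⁻¹ : ℝ) : ℂ)⁻¹ * c + ((1 + q ^ 2 : ℝ) : ℂ)) _ ?_)
  rw [add_smul, mul_smul, h', inv_smul_smul₀ hk, sub_add_cancel]

end nuMeasure

/-- the spectrum of the bounded self-adjoint operator `Δ` on `L²(dν)q⁰` equals
the segment `[−1/(1−q)², −1/(1+q)²]` and its point spectrum is empty. -/
theorem deltaQ_spectrum (q : ℝ) (hq : q ∈ Set.Ioo (0 : ℝ) 1) :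
    ∃ T : MeasureTheory.Lp ℂ 2 (nuMeasure q) →L[ℂ] MeasureTheory.Lp ℂ 2 (nuMeasure q),
      (∀ f : MeasureTheory.Lp ℂ 2 (nuMeasure q), ∀ m : ℕ, (T f) m = DeltaQ q (⇑f) m) ∧
      spectrum ℂ T
        = Complex.ofReal '' Set.Icc (-(1 / (1 - q) ^ 2)) (-(1 / (1 + q) ^ 2)) ∧
      (∀ (c : ℂ) (f : MeasureTheory.Lp ℂ 2 (nuMeasure q)), T f = c • f → f = 0) := by
  exact ⟨DeltaQOp hq, DeltaQOp_apply hq, spectrum_DeltaQOp hq, DeltaQOp_eigenvector_eq_zero hq⟩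

end
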